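/- Consider the universal r-periodic infinite frieze with growth coefficients s_0 = 2 and s_k = a_{rk,j} - a_{rk-2,j+1} for k \ge 1 (independent of j). Then s_{k+2} = s_1·s_{k+1} - s_k for all k \ge 0. -/

import Mathlib

open MvPolynomial

/-- The universal `r`-periodic infinite frieze, with values in the polynomial ring
`ℤ[z_0, …, z_{r-1}]` (variables indexed by `ZMod r`): `a i j = 0` for `i < 0`
(convention), `a 0 j = 1` (empty determinant), and for `i ≥ 1`, `a i j` is the
determinant of the `i × i` tridiagonal matrix with diagonal entries
`z_j, z_{j+1}, …, z_{j+i-1}` (variable indices taken modulo `r`) and all sub- and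
super-diagonal entries equal to `1`. -/
noncomputable def univAP (r : ℕ) (i : ℤ) (j : ℤ) : MvPolynomial (ZMod r) ℤ :=
  if i < 0 then 0
  else
    (Matrix.of fun k l : Fin i.toNat =>
      if (k : ℕ) = (l : ℕ) then X (((j + (k : ℕ) : ℤ) : ZMod r))
      else if (k : ℕ) + 1 = (l : ℕ) ∨ (l : ℕ) + 1 = (k : ℕ) then 1 else 0).det

/-- The `n × n` tridiagonal matrix whose determinant is `univAP r n j`. -/
noncomputable def friezeMatrix (r n : ℕ) (j : ℤ) :
    Matrix (Fin n) (Fin n) (MvPolynomial (ZMod r) ℤ) :=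
  Matrix.of fun k l : Fin n =>
    if (k : ℕ) = (l : ℕ) then X (((j + (k : ℕ) : ℤ) : ZMod r))
    else if (k : ℕ) + 1 = (l : ℕ) ∨ (l : ℕ) + 1 = (k : ℕ) then 1 else 0

lemma univAP_natCast (r n : ℕ) (j : ℤ) : univAP r n j = (friezeMatrix r n j).det := by
  rw [univAP, if_neg (by omega)]
  rfl

lemma univAP_of_neg (r : ℕ) {i : ℤ} (hi : i < 0) (j : ℤ) : univAP r i j = 0 :=
  if_pos hi

lemma univAP_zero (r : ℕ) (j : ℤ) : univAP r 0 j = 1 := by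
  simpa using univAP_natCast r 0 j

lemma univAP_one (r : ℕ) (j : ℤ) : univAP r 1 j = X (j : ZMod r) := by
  simpa [friezeMatrix] using univAP_natCast r 1 j

lemma friezeMatrix_submatrix_succ (r n : ℕ) (j : ℤ) :
    (friezeMatrix r (n + 1) j).submatrix Fin.succ Fin.succ = friezeMatrix r n (j + 1) := by
  ext1 k l
  simp [friezeMatrix, add_comm, add_left_comm]

lemma det_friezeMatrix_add_two (r n : ℕ) (j : ℤ) :
    (friezeMatrix r (n + 2) j).det =
      X (j : ZMod r) * (friezeMatrix r (n + 1) (j + 1)).det - (friezeMatrix r n (j + 2)).det := by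
  have minor : ((friezeMatrix r (n + 2) j).submatrix Fin.succ (Fin.succAbove 1)).det =
      (friezeMatrix r n (j + 2)).det := by
    have hsub : ((friezeMatrix r (n + 2) j).submatrix Fin.succ (Fin.succAbove 1)).submatrix
        Fin.succ Fin.succ = friezeMatrix r n (j + 2) := by
      rw [show j + 2 = j + 1 + 1 by ring, ← friezeMatrix_submatrix_succ,
        ← friezeMatrix_submatrix_succ]
      ext1 k l
      simp [Matrix.submatrix_apply]
    rw [Matrix.det_succ_column_zero, Fin.sum_univ_succ, Finset.sum_eq_zero]
    · simp only [Fin.succAbove_zero, hsub]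
      simp [friezeMatrix]
    · intro k _
      simp [friezeMatrix]
  rw [Matrix.det_succ_row_zero, Fin.sum_univ_succ, Fin.sum_univ_succ, Finset.sum_eq_zero]
  · simp only [Fin.succAbove_zero, friezeMatrix_submatrix_succ, Fin.succ_zero_eq_one, minor]
    simp [friezeMatrix, sub_eq_add_neg]
  · intro k _
    simp [friezeMatrix]

lemma univAP_eq_sub (r : ℕ) {i : ℤ} (hi : 1 ≤ i) (j : ℤ) :
    univAP r i j =
      X (j : ZMod r) * univAP r (i - 1) (j + 1) - univAP r (i - 2) (j + 1 + 1) := by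
  obtain rfl | hi := hi.eq_or_lt
  · simp [univAP_one, univAP_zero, univAP_of_neg]
  · obtain ⟨n, rfl⟩ : ∃ n : ℕ, i = n + 2 := ⟨(i - 2).toNat, by omega⟩
    have h := det_friezeMatrix_add_two r n j
    simp only [← univAP_natCast] at h
    push_cast at h
    rw [h]
    ring_nf

/-- The product of the `n` transfer matrices of the frieze starting at position `j`. -/
noncomputable def transferProd (r : ℕ) : ℕ → ℤ → Matrix (Fin 2) (Fin 2) (MvPolynomial (ZMod r) ℤ)
  | 0, _ => 1
  | n + 1, j => !![X (j : ZMod r), -1; 1, 0] * transferProd r n (j + 1)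

lemma transferProd_add (r m n : ℕ) (j : ℤ) :
    transferProd r (m + n) j = transferProd r m j * transferProd r n (j + m) := by
  induction m generalizing j with
  | zero => simp [transferProd]
  | succ m ih =>
    rw [add_right_comm, transferProd, ih, transferProd, mul_assoc]
    push_cast
    rw [add_assoc j, add_comm (1 : ℤ)]

lemma transferProd_add_period (r n : ℕ) (j : ℤ) :
    transferProd r n (j + r) = transferProd r n j := by
  induction n generalizing j with
  | zero => rfl
  | succ n ih => simp [transferProd, ← ih (j + 1), add_right_comm]

lemma transferProd_mul (r k : ℕ) (j : ℤ) :
    transferProd r (r * k) j = transferProd r r j ^ k := by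
  induction k with
  | zero => rfl
  | succ k ih =>
    rw [Nat.mul_succ, add_comm, transferProd_add, transferProd_add_period, ih, pow_succ']

lemma det_transferProd (r n : ℕ) (j : ℤ) : (transferProd r n j).det = 1 := by
  induction n generalizing j with
  | zero => simp [transferProd]
  | succ n ih => rw [transferProd, Matrix.det_mul, ih, Matrix.det_fin_two_of]; ring

lemma transferProd_succ_eq (r n : ℕ) (j : ℤ) :
    transferProd r (n + 1) j =
      !![univAP r (n + 1) j, -univAP r n j;
        univAP r n (j + 1), -univAP r (n - 1) (j + 1)] := by
  induction n generalizing j with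
  | zero => simp [transferProd, univAP_zero, univAP_one, univAP_of_neg]
  | succ n ih =>
    rw [transferProd, ih, Matrix.mul_fin_two]
    push_cast
    rw [univAP_eq_sub r (i := n + 1 + 1) (by omega) j, univAP_eq_sub r (i := n + 1) (by omega) j]
    ring_nf

lemma trace_transferProd (r : ℕ) {n : ℕ} (hn : 1 ≤ n) (j : ℤ) :
    (transferProd r n j).trace = univAP r n j - univAP r (n - 2) (j + 1) := by
  obtain ⟨n, rfl⟩ := Nat.exists_eq_add_of_le' hn
  rw [transferProd_succ_eq, Matrix.trace_fin_two_of]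
  push_cast
  ring_nf

lemma Matrix.trace_pow_add_two_of_det_eq_one {R : Type*} [CommRing R]
    (A : Matrix (Fin 2) (Fin 2) R) (hA : A.det = 1) (k : ℕ) :
    (A ^ (k + 2)).trace = A.trace * (A ^ (k + 1)).trace - (A ^ k).trace := by
  have hsq : A ^ 2 = A.trace • A - 1 := by
    rw [Matrix.det_fin_two] at hA
    ext i j
    fin_cases i <;> fin_cases j <;>
      simp [pow_two, Matrix.mul_apply, Matrix.trace_fin_two] <;> grind
  rw [pow_add, hsq, mul_sub, mul_one, mul_smul_comm, ← pow_succ, Matrix.trace_sub,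
    Matrix.trace_smul, smul_eq_mul]

/-- The growth coefficients `s 0 = 2`,
`s k = a (r*k) j - a (r*k - 2) (j+1)` (for `k ≥ 1`, independent of `j`) of the
universal `r`-periodic infinite frieze satisfy `s (k+2) = s 1 * s (k+1) - s k`. -/
theorem universal_periodic_growth_coefficients_chebyshev
    (r : ℕ) (hr : 1 ≤ r) (s : ℕ → MvPolynomial (ZMod r) ℤ)
    (hs0 : s 0 = 2)
    (hs : ∀ k : ℕ, 1 ≤ k → ∀ j : ℤ,
      s k = univAP r ((r : ℤ) * k) j - univAP r ((r : ℤ) * k - 2) (j + 1)) :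
    ∀ k : ℕ, s (k + 2) = s 1 * s (k + 1) - s k := by
  have trace_eq (k : ℕ) : s k = (transferProd r r 0 ^ k).trace := by
    obtain rfl | hk := k.eq_zero_or_pos
    · simp [hs0]
    · rw [← transferProd_mul, trace_transferProd r (Nat.mul_pos hr hk), hs k hk 0]
      push_cast
      rfl
  intro k
  simpa [trace_eq] using
    Matrix.trace_pow_add_two_of_det_eq_one _ (det_transferProd r r 0) k
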